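/- For every ε > 0 there exists Q₀ such that the following holds for every prime q ≥ Q₀. Let a be an integer coprime to q, let κ ∈ {-1, +1}, and let N ≥ q^{2+ε}. If λ(n) = κ for every positive integer n ≤ N with n ≡ a (mod q), then: (1) λ(n + q) = λ(n) for every positive integer n ≤ N/q - q with gcd(n, q) = 1; and (2) #{1 ≤ n < q : gcd(n,q) = 1, λ(n) = -1} = φ(q)/2 = #{1 ≤ n < q : gcd(n,q) = 1, λ(n) = +1}. -/

import Mathlib

open scoped BigOperators

/-- The Liouville function `λ(n) = (-1)^Ω(n)`. -/
def liouville (n : ℕ) : ℤ := (-1) ^ (ArithmeticFunction.cardFactors n)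

theorem liouville_mul {m n : ℕ} (hm : m ≠ 0) (hn : n ≠ 0) :
    liouville (m * n) = liouville m * liouville n := by
  simp only [liouville, ArithmeticFunction.cardFactors_mul hm hn, pow_add]

theorem liouville_eq_neg_one_or_one (n : ℕ) : liouville n = -1 ∨ liouville n = 1 :=
  (neg_one_pow_eq_or ℤ _).symm

theorem liouville_ne_zero (n : ℕ) : liouville n ≠ 0 := by
  rcases liouville_eq_neg_one_or_one n with h | h <;> simp [h]

theorem liouville_two_mul {n : ℕ} (hn : n ≠ 0) : liouville (2 * n) = -liouville n := by
  rw [liouville_mul two_ne_zero hn]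
  simp [liouville, ArithmeticFunction.cardFactors_apply_prime Nat.prime_two]

/-- A residue class coprime to the prime `q` contains a multiple of each `n` coprime to `q`,
with cofactor less than `q`. -/
theorem exists_mul_modEq_of_coprime {q : ℕ} (hq : q.Prime) {a : ℤ} (ha : Int.gcd a q = 1)
    {n : ℕ} (hn : n.Coprime q) :
    ∃ m : ℕ, 0 < m ∧ m < q ∧ ((m * n : ℕ) : ℤ) ≡ a [ZMOD (q : ℤ)] := by
  have : Fact q.Prime := ⟨hq⟩
  have ha0 : (a : ZMod q) ≠ 0 := by
    rw [Ne, ZMod.intCast_zmod_eq_zero_iff_dvd]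
    intro h
    have h' := Int.gcd_eq_right (by positivity) h
    rw [ha] at h'
    exact hq.one_lt.ne (by exact_mod_cast h')
  have hn0 : (n : ZMod q) ≠ 0 := by
    rw [Ne, ZMod.natCast_eq_zero_iff]
    exact (hq.coprime_iff_not_dvd).1 hn.symm
  refine ⟨((a : ZMod q) * (n : ZMod q)⁻¹).val, ?_, ZMod.val_lt _, ?_⟩
  · rw [Nat.pos_iff_ne_zero, Ne, ZMod.val_eq_zero]
    exact mul_ne_zero ha0 (inv_ne_zero hn0)
  · rw [← ZMod.intCast_eq_intCast_iff]
    push_cast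
    rw [ZMod.natCast_zmod_val, inv_mul_cancel_right₀ hn0]

/-- If `liouville` is constant on a residue class coprime to the prime `q` up to `N`, then it is
`q`-periodic on the integers coprime to `q` up to `N / q`. -/
theorem liouville_add_eq_of_constant {q : ℕ} (hq : q.Prime) {a : ℤ} (ha : Int.gcd a q = 1)
    {κ : ℤ} {N : ℝ}
    (h : ∀ n : ℕ, 0 < n → (n : ℝ) ≤ N → (n : ℤ) ≡ a [ZMOD (q : ℤ)] → liouville n = κ)
    {n : ℕ} (hn0 : 0 < n) (hnN : (n : ℝ) ≤ N / q - q) (hn : n.Coprime q) :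
    liouville (n + q) = liouville n := by
  obtain ⟨m, hm0, hmq, hm⟩ := exists_mul_modEq_of_coprime hq ha hn
  have hq0 : (0 : ℝ) < q := by exact_mod_cast hq.pos
  have hmul : ((m * (n + q) : ℕ) : ℝ) ≤ N := by
    have h1 : ((n : ℝ) + q) * q ≤ N := (le_div_iff₀ hq0).1 (by linarith)
    have h2 : (m : ℝ) ≤ q := by exact_mod_cast hmq.le
    push_cast
    nlinarith [mul_le_mul_of_nonneg_right h2 (by positivity : (0 : ℝ) ≤ (n : ℝ) + q)]
  have hle : ((m * n : ℕ) : ℝ) ≤ N :=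
    le_trans (by exact_mod_cast Nat.mul_le_mul_left m (Nat.le_add_right n q)) hmul
  have e1 := h (m * n) (by positivity) hle hm
  have e2 := h (m * (n + q)) (by positivity) hmul (by
    refine Int.ModEq.trans ?_ hm
    rw [mul_add]
    push_cast
    exact Int.modEq_iff_dvd.2 ⟨-m, by ring⟩)
  rw [liouville_mul hm0.ne' (by positivity)] at e1 e2
  exact mul_left_cancel₀ (liouville_ne_zero m) (e2.trans e1.symm)

/-- If `liouville` is `q`-periodic below `q`, then doubling modulo the odd prime `q` flips it. -/
theorem liouville_two_mul_mod {q : ℕ} (hq : q.Prime) (hq2 : q ≠ 2)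
    (h : ∀ n : ℕ, 0 < n → n < q → liouville (n + q) = liouville n)
    {n : ℕ} (hn0 : 0 < n) (hnq : n < q) :
    0 < 2 * n % q ∧ liouville (2 * n % q) = -liouville n := by
  have hodd := hq.eq_two_or_odd.resolve_left hq2
  rw [← liouville_two_mul hn0.ne']
  rcases lt_or_ge (2 * n) q with hlt | hge
  · rw [Nat.mod_eq_of_lt hlt]
    exact ⟨by omega, rfl⟩
  · have hmod : 2 * n % q = 2 * n - q := by
      rw [Nat.mod_eq_sub_mod hge, Nat.mod_eq_of_lt (by omega)]
    rw [hmod]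
    refine ⟨by omega, ?_⟩
    rw [← h (2 * n - q) (by omega) (by omega), Nat.sub_add_cancel hge]

open Classical in
theorem card_liouville_le_card_liouville_neg {q : ℕ} (hq : q.Prime) (hq2 : q ≠ 2)
    (h : ∀ n : ℕ, 0 < n → n < q → liouville (n + q) = liouville n) (s : ℤ) :
    ((Finset.Ico 1 q).filter (fun n => n.Coprime q ∧ liouville n = s)).card ≤
      ((Finset.Ico 1 q).filter (fun n => n.Coprime q ∧ liouville n = -s)).card := by
  refine Finset.card_le_card_of_injOn (fun n => 2 * n % q) ?_ ?_
  · intro n hn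
    simp only [Finset.coe_filter, Finset.mem_Ico, Set.mem_ofPred_eq] at hn ⊢
    obtain ⟨hpos, hl⟩ := liouville_two_mul_mod hq hq2 h (by omega) hn.1.2
    have hlt := Nat.mod_lt (2 * n) hq.pos
    exact ⟨⟨hpos, hlt⟩, (Nat.coprime_of_lt_prime hpos.ne' hlt hq).symm, by rw [hl, hn.2.2]⟩
  · intro m hm n hn hmn
    simp only [Finset.coe_filter, Finset.mem_Ico, Set.mem_ofPred_eq] at hm hn
    have hcop : Nat.gcd q 2 = 1 := (Nat.coprime_primes hq Nat.prime_two).2 hq2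
    exact (Nat.ModEq.cancel_left_of_coprime hcop hmn).eq_of_lt_of_lt hm.1.2 hn.1.2

open Classical in
theorem card_liouville_add_card_liouville {q : ℕ} (hq : q.Prime) :
    ((Finset.Ico 1 q).filter (fun n => n.Coprime q ∧ liouville n = -1)).card +
      ((Finset.Ico 1 q).filter (fun n => n.Coprime q ∧ liouville n = 1)).card =
        Nat.totient q := by
  rw [← Finset.card_union_of_disjoint, ← Finset.filter_or, Finset.filter_true_of_mem,
    Nat.card_Ico, Nat.totient_prime hq]
  · intro n hn
    rw [Finset.mem_Ico] at hn
    rw [← and_or_left]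
    exact ⟨(Nat.coprime_of_lt_prime (by omega) hn.2 hq).symm, liouville_eq_neg_one_or_one n⟩
  · refine Finset.disjoint_filter.2 fun n _ h1 h2 => ?_
    have := h1.2.symm.trans h2.2
    norm_num at this

/-- For `ε > 0`, eventually `2 * q ^ 2 ≤ q ^ (2 + ε)`. -/
theorem exists_two_mul_sq_le_rpow {ε : ℝ} (hε : 0 < ε) :
    ∃ Q : ℕ, ∀ q : ℕ, Q ≤ q → 0 < q → 2 * (q : ℝ) ^ 2 ≤ (q : ℝ) ^ ((2 : ℝ) + ε) := by
  obtain ⟨Q, hQ⟩ := Filter.eventually_atTop.1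
    (((tendsto_rpow_atTop hε).comp tendsto_natCast_atTop_atTop).eventually_ge_atTop (2 : ℝ))
  refine ⟨Q, fun q hq hq0 => ?_⟩
  have h2 : (2 : ℝ) ≤ (q : ℝ) ^ ε := hQ q hq
  rw [Real.rpow_add (by exact_mod_cast hq0), Real.rpow_two, mul_comm]
  gcongr

open Classical in
theorem constant_sign_implies_periodicity_and_equidistribution
    (ε : ℝ) (hε : 0 < ε) :
    ∃ Q₀ : ℕ, ∀ q : ℕ, q.Prime → Q₀ ≤ q →
      ∀ a : ℤ, Int.gcd a q = 1 →
        ∀ κ : ℤ, (κ = -1 ∨ κ = 1) →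
          ∀ N : ℝ, (q : ℝ) ^ ((2 : ℝ) + ε) ≤ N →
            (∀ n : ℕ, 0 < n → (n : ℝ) ≤ N → (n : ℤ) ≡ a [ZMOD (q : ℤ)] →
              liouville n = κ) →
            (∀ n : ℕ, 0 < n → (n : ℝ) ≤ N / q - q → n.Coprime q →
                liouville (n + q) = liouville n) ∧
            2 * ((Finset.Ico 1 q).filter
                (fun n => n.Coprime q ∧ liouville n = -1)).card = Nat.totient q ∧
            2 * ((Finset.Ico 1 q).filter
                (fun n => n.Coprime q ∧ liouville n = 1)).card = Nat.totient q := by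
  obtain ⟨Q, hQ⟩ := exists_two_mul_sq_le_rpow hε
  refine ⟨max Q 3, fun q hq hQq a ha κ _ N hN h => ?_⟩
  have hper := fun n (h0 : 0 < n) hnN hn => liouville_add_eq_of_constant hq ha h (n := n) h0 hnN hn
  have hq0 : (0 : ℝ) < q := by exact_mod_cast hq.pos
  have hqN : (q : ℝ) ≤ N / q - q := by
    have h2 := (hQ q ((le_max_left _ _).trans hQq) hq.pos).trans hN
    have : 2 * (q : ℝ) ≤ N / q := (le_div_iff₀ hq0).2 (by linarith)
    linarith
  have hq2 : q ≠ 2 := by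
    have := (le_max_right Q 3).trans hQq
    omega
  have hlow : ∀ n : ℕ, 0 < n → n < q → liouville (n + q) = liouville n := fun n h0 hn =>
    hper n h0 (le_trans (by exact_mod_cast hn.le) hqN) ((Nat.coprime_of_lt_prime h0.ne' hn hq).symm)
  have hle := card_liouville_le_card_liouville_neg hq hq2 hlow 1
  have hge := card_liouville_le_card_liouville_neg hq hq2 hlow (-1)
  rw [neg_neg] at hge
  have hsum := card_liouville_add_card_liouville hq
  exact ⟨hper, by omega, by omega⟩
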